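/- Let H(q,p) = ½ pᵀ M(q)⁻¹ p + V(q) be the Hamiltonian of an n-degree-of-freedom conservative mechanical system, with M smooth, symmetric positive definite valued and V smooth, and assume the associated Hamiltonian vector field is continuously differentiable (so solutions of initial value problems are unique). Suppose q, p : ℝ → ℝⁿ solve Hamilton's equations with p(0) = 0, and suppose t̄ > 0 is a time with p(t̄) = 0 and q(t̄) ≠ q(0). Then the trajectory is periodic with period T = 2 t̄, and moreover p(t̄/1 · T/2) = p(t̄) = 0, q(T) = q(0), and p(T) = 0. -/

import Mathlib

open Matrix

/-- The vector of partial derivatives of `f` at `x` (the gradient in coordinates). -/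
noncomputable def pderivVec {n : ℕ} (f : (Fin n → ℝ) → ℝ) (x : Fin n → ℝ) : Fin n → ℝ :=
  fun i => fderiv ℝ f x (Pi.single i 1)

/-- Global uniqueness of solutions of the autonomous ODE driven by a `C¹` vector field `F`. -/
theorem eq_of_hasDerivAt_of_contDiff {E : Type*} [NormedAddCommGroup E] [NormedSpace ℝ E]
    {F : E → E} (hF : ContDiff ℝ 1 F) {f g : ℝ → E}
    (hf : ∀ t, HasDerivAt f (F (f t)) t) (hg : ∀ t, HasDerivAt g (F (g t)) t)
    {t₀ : ℝ} (h : f t₀ = g t₀) : f = g := by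
  ext t
  obtain ⟨a, b, ht, ht₀⟩ : ∃ a b, t ∈ Set.Ioo a b ∧ t₀ ∈ Set.Ioo a b := by
    use min t t₀ - 1, max t t₀ + 1
    grind
  have hfc : Continuous f := continuous_iff_continuousAt.2 fun s => (hf s).continuousAt
  have hgc : Continuous g := continuous_iff_continuousAt.2 fun s => (hg s).continuousAt
  have hK : IsCompact (f '' Set.Icc a b ∪ g '' Set.Icc a b) :=
    (isCompact_Icc.image hfc).union (isCompact_Icc.image hgc)
  obtain ⟨K, hLip⟩ :=
    hF.locallyLipschitz.locallyLipschitzOn.exists_lipschitzOnWith_of_compact hK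
  exact ODE_solution_unique_of_mem_Ioo (v := fun _ => F) (fun _ _ => hLip) ht₀
    (fun s hs => ⟨hf s, Or.inl (Set.mem_image_of_mem f (Set.Ioo_subset_Icc_self hs))⟩)
    (fun s hs => ⟨hg s, Or.inr (Set.mem_image_of_mem g (Set.Ioo_subset_Icc_self hs))⟩) h ht

theorem pderivVec_neg_of_even {n : ℕ} {f : (Fin n → ℝ) → ℝ} (hf : ∀ x, f (-x) = f x)
    (x : Fin n → ℝ) : pderivVec f (-x) = -pderivVec f x := by
  have h : fderiv ℝ f x = -fderiv ℝ f (-x) := by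
    simpa [hf] using fderiv_comp_smul (f := f) (x := x) (-1 : ℝ)
  ext i
  simp [pderivVec, h]

/-- Time-reversal symmetry: a trajectory of a Hamiltonian that is even in the momentum is
symmetric about every instant at which the momentum vanishes. -/
theorem hamiltonian_reflect_of_momentum_eq_zero {n : ℕ} {H : (Fin n → ℝ) → (Fin n → ℝ) → ℝ}
    (hEven : ∀ q p, H q (-p) = H q p)
    (hX : ContDiff ℝ 1 (fun x : (Fin n → ℝ) × (Fin n → ℝ) =>
      (pderivVec (fun p' => H x.1 p') x.2, -pderivVec (fun q' => H q' x.2) x.1)))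
    {q p : ℝ → Fin n → ℝ}
    (hq : ∀ t, HasDerivAt q (pderivVec (fun p' => H (q t) p') (p t)) t)
    (hp : ∀ t, HasDerivAt p (-pderivVec (fun q' => H q' (p t)) (q t)) t)
    {a : ℝ} (ha : p a = 0) (t : ℝ) : q (2 * a - t) = q t ∧ p (2 * a - t) = -p t := by
  have key : (fun t => (q t, p t)) = fun t => (q (2 * a - t), -p (2 * a - t)) := by
    refine eq_of_hasDerivAt_of_contDiff hX (t₀ := a) (fun s => (hq s).prodMk (hp s))
      (fun s => ?_) ?_
    · have h₁ := (hq (2 * a - s)).comp_const_sub (2 * a) s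
      have h₂ := ((hp (2 * a - s)).comp_const_sub (2 * a) s).neg
      have h := h₁.prodMk h₂
      rw [← pderivVec_neg_of_even (hEven _)] at h
      simpa [hEven] using h
    · simp [two_mul, ha]
  have h := congrFun key t
  simp only [Prod.mk.injEq] at h
  exact ⟨h.1.symm, by rw [h.2, neg_neg]⟩

/-- An eigenmode-type trajectory of the mechanical Hamiltonian system
`H(q,p) = ½ pᵀ M(q)⁻¹ p + V(q)` with `p(0) = 0`, which reaches another rest point at
time `t̄ > 0` (`p(t̄) = 0`, `q(t̄) ≠ q(0)`), is periodic with period `T = 2 t̄`; moreover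
`p(T/2) = p(t̄) = 0`, `q(T) = q(0)` and `p(T) = 0`. -/
theorem eigenmode_period_two_tbar {n : ℕ}
    (M : (Fin n → ℝ) → Matrix (Fin n) (Fin n) ℝ)
    (hMsmooth : ∀ i j, ContDiff ℝ (⊤ : ℕ∞) fun q => M q i j)
    (hMsymm : ∀ q, (M q).IsSymm)
    (hMpd : ∀ q, (M q).PosDef)
    (V : (Fin n → ℝ) → ℝ) (hV : ContDiff ℝ (⊤ : ℕ∞) V)
    (H : (Fin n → ℝ) → (Fin n → ℝ) → ℝ)
    (hH : ∀ q p, H q p = (1 / 2 : ℝ) * (p ⬝ᵥ ((M q)⁻¹).mulVec p) + V q)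
    -- the Hamiltonian vector field is continuously differentiable
    (hX : ContDiff ℝ 1 (fun x : (Fin n → ℝ) × (Fin n → ℝ) =>
      (pderivVec (fun p' => H x.1 p') x.2, -pderivVec (fun q' => H q' x.2) x.1)))
    (q p : ℝ → Fin n → ℝ)
    (hq : ∀ t, HasDerivAt q (pderivVec (fun p' => H (q t) p') (p t)) t)
    (hp : ∀ t, HasDerivAt p (-pderivVec (fun q' => H q' (p t)) (q t)) t)
    (hp0 : p 0 = 0)
    (tbar : ℝ) (htbar : 0 < tbar) (hptbar : p tbar = 0) (hqtbar : q tbar ≠ q 0) :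
    (∀ t : ℝ, q (t + 2 * tbar) = q t ∧ p (t + 2 * tbar) = p t) ∧
    p (2 * tbar / 2) = 0 ∧ q (2 * tbar) = q 0 ∧ p (2 * tbar) = 0 := by
  have hEven : ∀ q p, H q (-p) = H q p := fun q p => by
    simp [hH, Matrix.mulVec_neg]
  have hzero := hamiltonian_reflect_of_momentum_eq_zero hEven hX hq hp hp0
  have hbar := hamiltonian_reflect_of_momentum_eq_zero hEven hX hq hp hptbar
  have hper : ∀ t : ℝ, q (t + 2 * tbar) = q t ∧ p (t + 2 * tbar) = p t := by
    intro t
    have h₀ := hzero t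
    have h₁ := hbar (-t)
    rw [show 2 * (0 : ℝ) - t = -t by ring] at h₀
    rw [show 2 * tbar - -t = t + 2 * tbar by ring, h₀.1, h₀.2, neg_neg] at h₁
    exact h₁
  have h := hper 0
  rw [zero_add] at h
  exact ⟨hper, by rw [mul_div_cancel_left₀ _ two_ne_zero, hptbar], h.1, h.2.trans hp0⟩
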